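/- In any conic sequence {𝒫_i}_{1≤i≤ℓ} of a convex polytope P, for each 2 ≤ i ≤ ℓ the face E_i has exactly one vertex (namely v_i) not contained in P_{i−1}, so dim E_i ≤ dim 𝒫_{i−1} + 1 and hence dim C_i ≤ dim 𝒫_{i−1}. -/

import Mathlib

open Set Polynomial Metric

/-! ### Polytopes, faces, and conic sequences -/

variable {V : Type*} [NormedAddCommGroup V] [NormedSpace ℝ V]

/-- A (convex) polytope: the convex hull of a finite set. -/
def IsPolytope (P : Set V) : Prop := ∃ S : Finset V, P = convexHull ℝ (S : Set V)

/-- `F` is a face of the polytope `P` (exposed face; this includes `∅` and `P` itself). -/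
def IsFaceOf (F P : Set V) : Prop := IsExposed ℝ P F

/-- The set of all faces of a polytope, i.e. the polytopal complex of all faces of `P`. -/
def faces (P : Set V) : Set (Set V) := {F | IsFaceOf F P}

/-- The dimension of a polytope (the affine dimension of the set). -/
noncomputable def polyDim (s : Set V) : ℕ := Module.finrank ℝ (vectorSpan ℝ s)

/-- The number `f_k(Q)` of `k`-dimensional (nonempty) faces of a polytope `Q`. -/
noncomputable def faceCount (Q : Set V) (k : ℕ) : ℕ :=
  Nat.card {F : Set V // IsFaceOf F Q ∧ F.Nonempty ∧ polyDim F = k}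

/-- The generating function `Φ_Q(x) = ∑_{k=0}^{dim Q} f_k(Q) x^k` of the face numbers. -/
noncomputable def faceGen (Q : Set V) : Polynomial ℚ :=
  ∑ k ∈ Finset.range (polyDim Q + 1), Polynomial.C ((faceCount Q k : ℚ)) * Polynomial.X ^ k

/-- The dimension of a collection of polytopes: the largest dimension of a member. -/
noncomputable def cpxDim (S : Set (Set V)) : ℕ := sSup (polyDim '' S)

/-- A conic sequence `𝒫 = 𝒫_ℓ, 𝒫_{ℓ-1}, …, 𝒫_1` of a polytopal complex with cell set `K`:
at each step `2 ≤ i ≤ ℓ`, one removes the interval `[v_i, E_i]`, where `v_i` is a cone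
vertex of `𝒫_i`, i.e. a vertex such that the subposet `{F ∈ 𝒫_i : v_i ∈ F}` has a unique
maximal (equivalently, greatest) element `E_i`; the sequence ends with `𝒫_1 = {∅, {v_1}}`. -/
structure ConicSeq (K : Set (Set V)) (ℓ : ℕ) where
  cpx : ℕ → Set (Set V)
  v : ℕ → V
  E : ℕ → Set V
  one_le : 1 ≤ ℓ
  top : cpx ℓ = K
  bottom : cpx 1 = {∅, {v 1}}
  vtx_mem : ∀ i, 2 ≤ i → i ≤ ℓ → {v i} ∈ cpx i
  E_mem : ∀ i, 2 ≤ i → i ≤ ℓ → E i ∈ cpx i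
  v_mem_E : ∀ i, 2 ≤ i → i ≤ ℓ → v i ∈ E i
  E_greatest : ∀ i, 2 ≤ i → i ≤ ℓ → ∀ F ∈ cpx i, v i ∈ F → F ⊆ E i
  step : ∀ i, 2 ≤ i → i ≤ ℓ → cpx (i - 1) = cpx i \ {F | F ∈ cpx i ∧ v i ∈ F ∧ F ⊆ E i}

/-- The interval `[v_i, E_i]` removed at step `i` of a conic sequence. -/
def ConicSeq.interval {K : Set (Set V)} {ℓ : ℕ} (cs : ConicSeq K ℓ) (i : ℕ) : Set (Set V) :=
  {F | F ∈ cs.cpx i ∧ cs.v i ∈ F ∧ F ⊆ cs.E i}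

/-- `C` is the intersection of the face `E` with an affine hyperplane separating the cone
vertex `vtx` from `Pprev ∩ E`, where `Pprev` is the geometric realization `P_{i-1}`. -/
def IsConeSlice (C : Set V) (E : Set V) (vtx : V) (Pprev : Set V) : Prop :=
  ∃ (f : V →L[ℝ] ℝ) (c : ℝ), c < f vtx ∧ (∀ x ∈ Pprev ∩ E, f x < c) ∧
    C = {x ∈ E | f x = c}

/-- `C i` is the cone-slice polytope `C_i` of the conic sequence `cs`, for `2 ≤ i ≤ ℓ`. -/
def ConicSeq.HasSlices {K : Set (Set V)} {ℓ : ℕ} (cs : ConicSeq K ℓ) (C : ℕ → Set V) : Prop :=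
  ∀ i, 2 ≤ i → i ≤ ℓ → IsConeSlice (C i) (cs.E i) (cs.v i) (⋃₀ cs.cpx (i - 1))

/-- A simplex: the convex hull of a nonempty affinely independent finite set. -/
def IsSimplex (C : Set V) : Prop :=
  ∃ S : Finset V, S.Nonempty ∧ AffineIndependent ℝ (fun x : {x // x ∈ S} => (x : V)) ∧
    C = convexHull ℝ (S : Set V)

/-- A polytope combinatorially equivalent to the `d`-dimensional cube `I^d = [0,1]^d`,
i.e. whose face poset is isomorphic to that of `[0,1]^d`. -/
def IsCombCube (C : Set V) (d : ℕ) : Prop :=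
  Nonempty ({F : Set V // IsFaceOf F C} ≃o
    {F : Set (Fin d → ℝ) // IsFaceOf F (Set.Icc (0 : Fin d → ℝ) 1)})

/-- A nondegenerate segment (a copy of the interval `I`). -/
def IsSegment (C : Set V) : Prop := ∃ a b : V, a ≠ b ∧ C = segment ℝ a b

/-- A facet: a nonempty face of codimension one. -/
def IsFacetOf (F P : Set V) : Prop := IsFaceOf F P ∧ F.Nonempty ∧ polyDim F + 1 = polyDim P

/-- A simple polytope: each vertex lies on exactly `dim`-many facets. -/
def IsSimplePolytope (P : Set V) : Prop :=
  IsPolytope P ∧ P.Nonempty ∧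
    ∀ w : V, IsFaceOf {w} P → Nat.card {F : Set V // IsFacetOf F P ∧ w ∈ F} = polyDim P

section Faces

variable {W : Type*} [NormedAddCommGroup W] [NormedSpace ℝ W]

lemma IsPolytope.isCompact {P : Set W} (hP : IsPolytope P) : IsCompact P := by
  obtain ⟨S, rfl⟩ := hP
  exact S.finite_toSet.isCompact_convexHull ℝ

lemma IsPolytope.convex {P : Set W} (hP : IsPolytope P) : Convex ℝ P := by
  obtain ⟨S, rfl⟩ := hP
  exact convex_convexHull ℝ _

/-- A weak upper bound for a continuous linear functional on a set extends to the convex hull. -/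
lemma le_of_mem_convexHull {S : Set W} (l : W →L[ℝ] ℝ) {a : ℝ} (h : ∀ s ∈ S, l s ≤ a)
    {x : W} (hx : x ∈ convexHull ℝ S) : l x ≤ a :=
  convexHull_min (t := {y | l y ≤ a}) h (convex_halfSpace_le l.toLinearMap.isLinear a) hx

/-- A face of a polytope is a polytope. -/
lemma IsFaceOf.isPolytope {F P : Set W} (hP : IsPolytope P) (hF : IsFaceOf F P) :
    IsPolytope F := by
  have hFc : IsCompact F := IsExposed.isCompact (𝕜 := ℝ) hF hP.isCompact
  have hconv : Convex ℝ F := IsExposed.convex (𝕜 := ℝ) hF hP.convex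
  have hsub : F.extremePoints ℝ ⊆ P.extremePoints ℝ :=
    (IsExposed.isExtreme (𝕜 := ℝ) hF).extremePoints_subset_extremePoints
  have hfin : (F.extremePoints ℝ).Finite := by
    obtain ⟨S, rfl⟩ := hP
    exact S.finite_toSet.subset (hsub.trans extremePoints_convexHull_subset)
  refine ⟨hfin.toFinset, ?_⟩
  rw [hfin.coe_toFinset]
  exact (closure_convexHull_extremePoints hFc hconv).symm.trans
    (hfin.isCompact_convexHull ℝ).isClosed.closure_eq

/-- A face of a face of a polytope is a face of the polytope. -/
lemma IsFaceOf.trans {G F P : Set W} (hP : IsPolytope P) (hF : IsFaceOf F P)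
    (hG : IsFaceOf G F) : IsFaceOf G P := by
  rintro ⟨x, hxG⟩
  have hGF : G ⊆ F := IsExposed.subset (𝕜 := ℝ) hG
  obtain ⟨l, hl⟩ := hF ⟨x, hGF hxG⟩
  obtain ⟨m, hm⟩ := hG ⟨x, hxG⟩
  obtain ⟨S, rfl⟩ := hP
  have hxF : x ∈ F := hGF hxG
  have hlx : ∀ y ∈ convexHull ℝ (S : Set W), l y ≤ l x := by
    rw [hl] at hxF; exact hxF.2
  have hmx : ∀ y ∈ F, m y ≤ m x := by
    rw [hm] at hxG; exact hxG.2
  have hFP : F ⊆ convexHull ℝ (S : Set W) := IsExposed.subset (𝕜 := ℝ) hF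
  have hFmem : ∀ y ∈ convexHull ℝ (S : Set W), l y = l x → y ∈ F := fun y hy h => by
    rw [hl]; exact ⟨hy, fun z hz => h ▸ hlx z hz⟩
  have hGmem : ∀ y ∈ F, m y = m x → y ∈ G := fun y hy h => by
    rw [hm]; exact ⟨hy, fun z hz => h ▸ hmx z hz⟩
  have hev : ∀ᶠ N : ℝ in Filter.atTop, ∀ s ∈ S, (N • l + m) s ≤ N * l x + m x := by
    rw [Filter.eventually_all_finset]
    intro s hs
    have hsP := subset_convexHull ℝ (S : Set W) hs
    rcases (hlx s hsP).eq_or_lt with h | h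
    · refine Filter.Eventually.of_forall fun N => ?_
      have := hmx s (hFmem s hsP h)
      simp only [add_apply, smul_apply, smul_eq_mul, h]
      linarith
    · filter_upwards [Filter.eventually_ge_atTop ((m s - m x) / (l x - l s))] with N hN
      rw [div_le_iff₀ (by linarith)] at hN
      simp only [add_apply, smul_apply, smul_eq_mul]
      linarith
  obtain ⟨N, hN⟩ := hev.exists
  have hNP : ∀ y ∈ convexHull ℝ (S : Set W), N * l y + m y ≤ N * l x + m x := fun y hy => by
    simpa using le_of_mem_convexHull (N • l + m) hN hy
  refine ⟨(N + 1) • l + m, Set.Subset.antisymm (fun y hy => ⟨hFP (hGF hy), fun z hz => ?_⟩) ?_⟩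
  · have h1 : l x ≤ l y := by
      have := hGF hy
      rw [hl] at this
      exact this.2 x (hFP hxF)
    have h2 : m x ≤ m y := by
      rw [hm] at hy
      exact hy.2 x hxF
    have h3 := hlx y (hFP (hGF hy))
    have h4 : l y = l x := le_antisymm h3 h1
    have := hlx z hz
    have := hNP z hz
    simp only [add_apply, smul_apply, smul_eq_mul, h4]
    linarith
  · rintro y ⟨hyP, hy⟩
    have h1 := hy x (hFP hxF)
    simp only [add_apply, smul_apply, smul_eq_mul] at h1
    have h2 := hNP y hyP
    have h3 := hlx y hyP
    have h4 : l y = l x := by linarith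
    have hyF := hFmem y hyP h4
    refine hGmem y hyF (le_antisymm (hmx y hyF) ?_)
    rw [h4] at h1
    linarith

/-- A face of a polytope contained in another face is a face of it. -/
lemma IsFaceOf.of_subset {G F P : Set W} (hG : IsFaceOf G P) (hGF : G ⊆ F) (hFP : F ⊆ P) :
    IsFaceOf G F := by
  intro hne
  obtain ⟨l, hl⟩ := hG hne
  obtain ⟨x, hx⟩ := hne
  refine ⟨l, Set.Subset.antisymm (fun y hy => ⟨hGF hy, fun z hz => ?_⟩) ?_⟩
  · rw [hl] at hy
    exact hy.2 z (hFP hz)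
  · rintro y ⟨hyF, hy⟩
    have hxy := hy x (hGF hx)
    rw [hl] at hx ⊢
    exact ⟨hFP hyF, fun z hz => (hx.2 z hz).trans hxy⟩

lemma IsPolytope.finiteDimensional_vectorSpan {P : Set W} (hP : IsPolytope P) :
    FiniteDimensional ℝ (vectorSpan ℝ P) := by
  obtain ⟨S, rfl⟩ := hP
  rw [← direction_affineSpan, affineSpan_convexHull, direction_affineSpan]
  exact finiteDimensional_vectorSpan_of_finite ℝ S.finite_toSet

lemma IsPolytope.polyDim_le {F P : Set W} (hP : IsPolytope P) (h : F ⊆ P) :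
    polyDim F ≤ polyDim P := by
  have := hP.finiteDimensional_vectorSpan
  exact Submodule.finrank_mono (vectorSpan_mono ℝ h)

/-- A finite-dimensional subspace can be separated from a point outside it by a continuous
linear functional vanishing on the subspace. -/
lemma exists_dual_pos_of_notMem (U : Submodule ℝ W) [FiniteDimensional ℝ U] {d : W}
    (hd : d ∉ U) : ∃ g : W →L[ℝ] ℝ, 0 < g d ∧ ∀ u ∈ U, g u = 0 := by
  obtain ⟨f, u, hu, hf⟩ := geometric_hahn_banach_closed_point (s := (U : Set W)) U.convex
    U.closed_of_finiteDimensional hd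
  have hz : ∀ w ∈ U, f w = 0 := by
    intro w hw
    by_contra h
    have := hu (((u + 1) / f w) • w) (U.smul_mem _ hw)
    rw [map_smul, smul_eq_mul, div_mul_cancel₀ _ h] at this
    linarith
  have h0 := hu 0 U.zero_mem
  rw [map_zero] at h0
  exact ⟨f, h0.trans hf, hz⟩

/-- A nonempty face that misses the vertex `v` and has codimension at least two is contained in a
face of larger dimension that still misses `v`. -/
lemma exists_larger_face_avoiding {E F : Set W} (hE : IsPolytope E) {v : W} (hv : v ∈ E)
    (hF : IsFaceOf F E) (hne : F.Nonempty) (hvF : v ∉ F) (hdim : polyDim F + 1 < polyDim E) :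
    ∃ F', IsFaceOf F' E ∧ F'.Nonempty ∧ v ∉ F' ∧ polyDim F < polyDim F' := by
  have hFP : IsPolytope F := hF.isPolytope hE
  have hFE : F ⊆ E := IsExposed.subset (𝕜 := ℝ) hF
  obtain ⟨l, hl⟩ := hF hne
  obtain ⟨x₀, hx₀⟩ := hne
  have := hE.finiteDimensional_vectorSpan
  have := hFP.finiteDimensional_vectorSpan
  let U : Submodule ℝ W := vectorSpan ℝ F ⊔ Submodule.span ℝ {v - x₀}
  have hUdim : Module.finrank ℝ U ≤ polyDim F + 1 :=
    (Submodule.finrank_add_le_finrank_add_finrank _ _).trans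
      (Nat.add_le_add_left ((finrank_span_le_card _).trans (by simp)) _)
  obtain ⟨x, hxE, hxU⟩ : ∃ x ∈ E, x - x₀ ∉ U := by
    by_contra! h
    have : vectorSpan ℝ E ≤ U := by
      rw [vectorSpan_eq_span_vsub_set_right ℝ (hFE hx₀), Submodule.span_le]
      rintro _ ⟨y, hy, rfl⟩
      exact h y hy
    have := Submodule.finrank_mono this
    unfold polyDim at hdim hUdim
    omega
  obtain ⟨g, hgx, hgU⟩ := exists_dual_pos_of_notMem U hxU
  have hgF : ∀ w ∈ vectorSpan ℝ F, g w = 0 := fun w hw => hgU w (Submodule.mem_sup_left hw)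
  have hgv : g v = g x₀ := by
    have := hgU _ (Submodule.mem_sup_right (Submodule.mem_span_singleton_self (v - x₀)))
    rwa [map_sub, sub_eq_zero] at this
  have hlx₀ : ∀ y ∈ E, l y ≤ l x₀ := by
    rw [hl] at hx₀; exact hx₀.2
  have hFmem : ∀ y ∈ E, l y = l x₀ → y ∈ F := fun y hy h => by
    rw [hl]; exact ⟨hy, fun z hz => h ▸ hlx₀ z hz⟩
  have hlv : l v < l x₀ := (hlx₀ v hv).lt_of_ne fun h => hvF (hFmem v hv h)
  obtain ⟨T, rfl⟩ := hE
  have hTE : ∀ s ∈ T, s ∈ convexHull ℝ (T : Set W) := fun s hs => subset_convexHull ℝ _ hs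
  have hT' : (T.filter fun s => g x₀ < g s).Nonempty := by
    by_contra h
    rw [Finset.not_nonempty_iff_eq_empty, Finset.filter_eq_empty_iff] at h
    have := le_of_mem_convexHull (S := (T : Set W)) g (fun s hs => not_lt.1 (h hs)) hxE
    rw [map_sub] at hgx
    linarith
  obtain ⟨s₀, hs₀, hmin⟩ :=
    Finset.exists_min_image _ (fun s => (l x₀ - l s) / (g s - g x₀)) hT'
  obtain ⟨hs₀T, hgs₀⟩ := Finset.mem_filter.1 hs₀
  set t := (l x₀ - l s₀) / (g s₀ - g x₀)
  have ht0 : 0 ≤ t := div_nonneg (by linarith [hlx₀ s₀ (hTE s₀ hs₀T)]) (by linarith)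
  have hts₀ : t * (g s₀ - g x₀) = l x₀ - l s₀ := div_mul_cancel₀ _ (by linarith)
  have hmax : ∀ y ∈ convexHull ℝ (T : Set W), (l + t • g) y ≤ (l + t • g) x₀ := by
    intro y hy
    refine le_of_mem_convexHull _ (fun s hs => ?_) hy
    have hls := hlx₀ s (hTE s hs)
    simp only [add_apply, smul_apply, smul_eq_mul]
    by_cases h : g x₀ < g s
    · have := hmin s (Finset.mem_filter.2 ⟨hs, h⟩)
      rw [le_div_iff₀ (by linarith)] at this
      linarith
    · have := mul_le_mul_of_nonneg_left (not_lt.1 h) ht0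
      linarith
  let F' : Set W := {y ∈ convexHull ℝ (T : Set W) |
    ∀ z ∈ convexHull ℝ (T : Set W), (l + t • g) z ≤ (l + t • g) y}
  have hF'mem : ∀ y ∈ convexHull ℝ (T : Set W), (l + t • g) y = (l + t • g) x₀ → y ∈ F' :=
    fun y hy h => ⟨hy, fun z hz => h ▸ hmax z hz⟩
  have hF' : IsFaceOf F' (convexHull ℝ (T : Set W)) := fun _ => ⟨l + t • g, rfl⟩
  have hx₀F' : x₀ ∈ F' := hF'mem x₀ (hFE hx₀) rfl
  have hs₀F' : s₀ ∈ F' := hF'mem s₀ (hTE s₀ hs₀T) (by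
    simp only [add_apply, smul_apply, smul_eq_mul]
    linarith)
  have hFF' : F ⊆ F' := fun y hy => hF'mem y (hFE hy) (by
    have h1 : g y = g x₀ := by
      have := hgF _ (vsub_mem_vectorSpan ℝ hy hx₀)
      rwa [vsub_eq_sub, map_sub, sub_eq_zero] at this
    have h2 : l y = l x₀ := by
      rw [hl] at hy
      exact le_antisymm (hlx₀ y hy.1) (hy.2 x₀ (hFE hx₀))
    simp [h1, h2])
  refine ⟨F', hF', ⟨x₀, hx₀F'⟩, fun hvF' => ?_, ?_⟩
  · have := hvF'.2 x₀ (hFE hx₀)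
    simp only [add_apply, smul_apply, smul_eq_mul,
      hgv] at this
    linarith
  · have := (hF'.isPolytope ⟨T, rfl⟩).finiteDimensional_vectorSpan
    refine Submodule.finrank_lt_finrank_of_lt
      (lt_of_le_of_ne (vectorSpan_mono ℝ hFF') fun h => ?_)
    have := hgF (s₀ -ᵥ x₀) (h ▸ vsub_mem_vectorSpan ℝ hs₀F' hx₀F')
    rw [vsub_eq_sub, map_sub] at this
    linarith

/-- A polytope that is not a single vertex `v` has a face of codimension at most one that
misses `v`. -/
lemma exists_face_avoiding {E : Set W} (hE : IsPolytope E) {v : W} (hv : IsFaceOf {v} E)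
    (hne : E ≠ {v}) : ∃ F, IsFaceOf F E ∧ v ∉ F ∧ polyDim E ≤ polyDim F + 1 := by
  have hvE : v ∈ E := IsExposed.subset (𝕜 := ℝ) hv (mem_singleton v)
  have hex : ∃ n F, IsFaceOf F E ∧ F.Nonempty ∧ v ∉ F ∧ polyDim F = n := by
    obtain ⟨l, hl⟩ := hv (singleton_nonempty v)
    obtain ⟨x, hxE, hx⟩ := hE.isCompact.exists_isMaxOn ⟨v, hvE⟩ (-l).continuous.continuousOn
    refine ⟨_, {y ∈ E | ∀ z ∈ E, (-l) z ≤ (-l) y}, fun _ => ⟨-l, rfl⟩, ⟨x, hxE, hx⟩, ?_, rfl⟩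
    rintro ⟨-, hvmin⟩
    refine hne (Set.Subset.antisymm (fun y hy => ?_) (singleton_subset_iff.2 hvE))
    have hvmax : v ∈ {y ∈ E | ∀ z ∈ E, l z ≤ l y} := hl ▸ mem_singleton v
    rw [hl]
    refine ⟨hy, fun z hz => (hvmax.2 z hz).trans ?_⟩
    simpa using hvmin y hy
  by_contra! h
  have hall : ∀ n, ∃ F, IsFaceOf F E ∧ F.Nonempty ∧ v ∉ F ∧ n ≤ polyDim F := by
    intro n
    induction n with
    | zero =>
      obtain ⟨_, F, hF, hFne, hvF, -⟩ := hex
      exact ⟨F, hF, hFne, hvF, Nat.zero_le _⟩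
    | succ n ih =>
      obtain ⟨F, hF, hFne, hvF, hn⟩ := ih
      obtain ⟨F', hF', hFne', hvF', hlt⟩ :=
        exists_larger_face_avoiding hE hvE hF hFne hvF (h F hF hvF)
      exact ⟨F', hF', hFne', hvF', by omega⟩
  obtain ⟨F, hF, -, -, hn⟩ := hall (polyDim E + 1)
  have := hE.polyDim_le (IsExposed.subset (𝕜 := ℝ) hF)
  omega

/-- A hyperplane section of a polytope that misses one of its points has smaller dimension. -/
lemma IsPolytope.polyDim_slice_lt {E : Set W} (hE : IsPolytope E) {v : W} (hv : v ∈ E)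
    (f : W →L[ℝ] ℝ) {c : ℝ} (hc : c < f v) (hne : {x ∈ E | f x = c}.Nonempty) :
    polyDim {x ∈ E | f x = c} < polyDim E := by
  have := hE.finiteDimensional_vectorSpan
  obtain ⟨x, hxE, hx⟩ := hne
  refine Submodule.finrank_lt_finrank_of_lt
    (lt_of_le_of_ne (vectorSpan_mono ℝ (sep_subset _ _)) fun h => ?_)
  have hker : vectorSpan ℝ {x ∈ E | f x = c} ≤ LinearMap.ker f.toLinearMap := by
    rw [vectorSpan, Submodule.span_le]
    rintro _ ⟨y, hy, z, hz, rfl⟩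
    simp [hy.2, hz.2]
  have h0 : f (v -ᵥ x) = 0 := hker (h ▸ vsub_mem_vectorSpan ℝ hv hxE)
  rw [vsub_eq_sub, map_sub, hx] at h0
  linarith

end Faces

namespace ConicSeq

lemma mem_cpx_pred_iff {W : Type*} {K : Set (Set W)} {ℓ : ℕ} (cs : ConicSeq K ℓ) {i : ℕ} (h2 : 2 ≤ i) (hi : i ≤ ℓ) {F : Set W} :
    F ∈ cs.cpx (i - 1) ↔ F ∈ cs.cpx i ∧ cs.v i ∉ F := by
  rw [cs.step i h2 hi]
  exact ⟨fun h => ⟨h.1, fun hv => h.2 ⟨h.1, hv, cs.E_greatest i h2 hi F h.1 hv⟩⟩,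
    fun h => ⟨h.1, fun h' => h.2 h'.2.1⟩⟩

/-- The members of a conic sequence of a polytope are complexes of faces that are closed under
taking faces. -/
lemma cpx_subset_faces_and_isFaceOf_closed {W : Type*} [NormedAddCommGroup W]
    [NormedSpace ℝ W] {ℓ : ℕ} {P : Set W} (hP : IsPolytope P)
    (cs : ConicSeq (faces P) ℓ) {i : ℕ} (h1 : 1 ≤ i) (hi : i ≤ ℓ) :
    cs.cpx i ⊆ faces P ∧ ∀ F ∈ cs.cpx i, ∀ G, IsFaceOf G F → G ∈ cs.cpx i := by
  induction hi using Nat.decreasingInduction with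
  | self =>
    rw [cs.top]
    exact ⟨subset_rfl, fun F hF G hG => IsFaceOf.trans hP hF hG⟩
  | of_succ i hi ih =>
    obtain ⟨hsub, hclosed⟩ := ih (by omega)
    have hpred : ∀ F, F ∈ cs.cpx i ↔ F ∈ cs.cpx (i + 1) ∧ cs.v (i + 1) ∉ F :=
      fun F => cs.mem_cpx_pred_iff (i := i + 1) (by omega) hi
    refine ⟨fun F hF => hsub ((hpred F).1 hF).1, fun F hF G hG => ?_⟩
    obtain ⟨hF, hvF⟩ := (hpred F).1 hF
    exact (hpred G).2 ⟨hclosed F hF G hG, fun hv => hvF (IsExposed.subset (𝕜 := ℝ) hG hv)⟩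

end ConicSeq

/-- In any conic sequence of a convex polytope `P`, for each `2 ≤ i ≤ ℓ` the face `E_i` has
exactly one vertex (namely `v_i`) not contained in `P_{i-1}`; hence
`dim E_i ≤ dim 𝒫_{i-1} + 1`, and therefore `dim C_i ≤ dim 𝒫_{i-1}` for any slice `C_i`. -/
theorem cone_vertex_unique_and_dim_bound
    {V : Type*} [NormedAddCommGroup V] [NormedSpace ℝ V]
    (P : Set V) (hP : IsPolytope P) (ℓ : ℕ) (cs : ConicSeq (faces P) ℓ)
    (i : ℕ) (h2i : 2 ≤ i) (hiℓ : i ≤ ℓ) :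
    {w : V | IsFaceOf {w} (cs.E i) ∧ w ∉ ⋃₀ cs.cpx (i - 1)} = {cs.v i} ∧
    polyDim (cs.E i) ≤ cpxDim (cs.cpx (i - 1)) + 1 ∧
    (∀ C : Set V, IsConeSlice C (cs.E i) (cs.v i) (⋃₀ cs.cpx (i - 1)) →
      polyDim C ≤ cpxDim (cs.cpx (i - 1))) := by
  obtain ⟨hsub, hclosed⟩ := cs.cpx_subset_faces_and_isFaceOf_closed hP (by omega) hiℓ
  have hEface : IsFaceOf (cs.E i) P := hsub (cs.E_mem i h2i hiℓ)
  have hE : IsPolytope (cs.E i) := hEface.isPolytope hP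
  have hvE : cs.v i ∈ cs.E i := cs.v_mem_E i h2i hiℓ
  have hv : IsFaceOf {cs.v i} (cs.E i) :=
    IsFaceOf.of_subset (hsub (cs.vtx_mem i h2i hiℓ)) (singleton_subset_iff.2 hvE)
      (IsExposed.subset (𝕜 := ℝ) hEface)
  have hpred : ∀ F, IsFaceOf F (cs.E i) → cs.v i ∉ F → F ∈ cs.cpx (i - 1) := fun F hF hvF =>
    (cs.mem_cpx_pred_iff h2i hiℓ).2 ⟨hclosed _ (cs.E_mem i h2i hiℓ) F hF, hvF⟩
  have hbdd : BddAbove (polyDim '' cs.cpx (i - 1)) := by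
    refine ⟨polyDim P, ?_⟩
    rintro _ ⟨F, hF, rfl⟩
    exact hP.polyDim_le (IsExposed.subset (𝕜 := ℝ) (hsub ((cs.mem_cpx_pred_iff h2i hiℓ).1 hF).1))
  have hdim : polyDim (cs.E i) ≤ cpxDim (cs.cpx (i - 1)) + 1 := by
    by_cases hEv : cs.E i = {cs.v i}
    · rw [hEv, polyDim, vectorSpan_singleton, finrank_bot]
      exact Nat.zero_le _
    · obtain ⟨F, hF, hvF, hle⟩ := exists_face_avoiding hE hv hEv
      have : polyDim F ≤ cpxDim (cs.cpx (i - 1)) :=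
        le_csSup hbdd (mem_image_of_mem _ (hpred F hF hvF))
      omega
  refine ⟨Set.Subset.antisymm ?_ ?_, hdim, ?_⟩
  · rintro w ⟨hw, hwP⟩
    by_contra hne
    exact hwP ⟨{w}, hpred {w} hw fun h => hne (mem_singleton_iff.1 h).symm, mem_singleton w⟩
  · rintro _ rfl
    refine ⟨hv, ?_⟩
    rintro ⟨F, hF, hvF⟩
    exact ((cs.mem_cpx_pred_iff h2i hiℓ).1 hF).2 hvF
  · rintro _ ⟨f, c, hc, -, rfl⟩
    rcases {x ∈ cs.E i | f x = c}.eq_empty_or_nonempty with h | h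
    · rw [h, polyDim, vectorSpan_empty, finrank_bot]
      exact Nat.zero_le _
    · have := hE.polyDim_slice_lt hvE f hc h
      omega
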